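/- Let n ≥ 1 and t ≥ 0 be integers with 2t+1 ≤ n, let T be a t-wise uniform set of permutations of {1,…,n} and let U be a (2t+1)-wise uniform set of permutations of {1,…,n}. Let r, s ≥ 0 satisfy r + s = 2t+1, let i_1,…,i_r be distinct elements of {1,…,n}, j_1,…,j_r distinct elements of {1,…,n}, k_1,…,k_s distinct elements of {1,…,n}, and ℓ_1,…,ℓ_s distinct elements of {1,…,n}. Then |{(σ,τ) ∈ T × U : τ(σ(i_a)) = j_a for all 1 ≤ a ≤ r, and τ(k_b) = ℓ_b for all 1 ≤ b ≤ s}| · (n!)^2 = |T| · |U| · (n−r)! · (n−s)!. -/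

import Mathlib

/-- A nonempty set `T` of permutations of `Fin n` is `t`-wise uniform if for every injective
tuple `i` and injective tuple `j` of `t` elements,
`|{σ ∈ T : σ(i_m) = j_m ∀ m}| · n·(n−1)⋯(n−t+1) = |T|`. -/
def IsTwiseUniform (n t : ℕ) (T : Finset (Equiv.Perm (Fin n))) : Prop :=
  T.Nonempty ∧ ∀ i j : Fin t → Fin n, Function.Injective i → Function.Injective j →
    (T.filter (fun σ => ∀ m, σ (i m) = j m)).card * Nat.descFactorial n t = T.card

/-- Number of members of `T` agreeing with `f` on `A` is as expected. -/
def GoodOn {n : ℕ} (T : Finset (Equiv.Perm (Fin n))) (A : Finset (Fin n)) : Prop :=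
  ∀ f : Equiv.Perm (Fin n),
    (T.filter (fun σ => ∀ a ∈ A, σ a = f a)).card * n.factorial
      = T.card * (n - A.card).factorial

lemma GoodOn.erase_one {n : ℕ} {T : Finset (Equiv.Perm (Fin n))} {A : Finset (Fin n)}
    {b : Fin n} (hb : b ∉ A) (h : GoodOn T (insert b A)) : GoodOn T A := by
  intro f
  have hlt : A.card < n := by
    have := Finset.card_le_univ (insert b A)
    rw [Finset.card_insert_of_notMem hb] at this
    simpa using this
  have hfib := Finset.card_eq_sum_card_fiberwise
    (s := T.filter (fun σ => ∀ a ∈ A, σ a = f a)) (t := (A.image f)ᶜ)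
    (f := fun σ => σ b) (by
      intro σ hσ
      simp only [Finset.coe_filter, Set.mem_ofPred_eq] at hσ
      simp only [Finset.coe_compl, Set.mem_compl_iff, Finset.mem_coe, Finset.mem_image, not_exists,
        not_and]
      intro a ha hab
      rw [← hσ.2 a ha] at hab
      exact hb (σ.injective hab ▸ ha))
  rw [hfib, Finset.sum_mul]
  have key : ∀ c ∈ (A.image f)ᶜ,
      ((T.filter (fun σ => ∀ a ∈ A, σ a = f a)).filter (fun σ => σ b = c)).card * n.factorial
        = T.card * (n - (A.card + 1)).factorial := by
    intro c hc
    rw [← Finset.card_insert_of_notMem hb, ← h (Equiv.swap (f b) c * f), Finset.filter_filter]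
    congr 2
    apply Finset.filter_congr
    intro σ _
    simp only [Finset.mem_insert, forall_eq_or_imp, Equiv.Perm.mul_apply, Equiv.swap_apply_left]
    rw [and_comm]
    refine and_congr_right fun _ => forall₂_congr fun a ha => ?_
    rw [Equiv.swap_apply_of_ne_of_ne]
    · intro e
      exact hb (f.injective e ▸ ha)
    · rintro rfl
      simp at hc
      exact hc ha
  rw [Finset.sum_congr rfl key, Finset.sum_const, Finset.card_compl,
    Finset.card_image_of_injective _ f.injective, Fintype.card_fin, smul_eq_mul,
    mul_left_comm, ← Nat.sub_sub, Nat.mul_factorial_pred (by omega)]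

lemma GoodOn.mono {n : ℕ} {T : Finset (Equiv.Perm (Fin n))} {A B : Finset (Fin n)}
    (hAB : A ⊆ B) (h : GoodOn T B) : GoodOn T A := by
  have : ∀ C : Finset (Fin n), Disjoint C A → GoodOn T (C ∪ A) → GoodOn T A := by
    intro C
    induction C using Finset.induction_on with
    | empty => intro _ h; simpa using h
    | insert b C hb ih =>
      intro hd h
      rw [Finset.disjoint_insert_left] at hd
      rw [Finset.insert_union] at h
      exact ih hd.2 (h.erase_one (by simp [hb, hd.1]))
  exact this (B \ A) Finset.sdiff_disjoint (by rwa [Finset.sdiff_union_of_subset hAB])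

lemma goodOn_univ {n : ℕ} (A : Finset (Fin n)) :
    GoodOn (Finset.univ : Finset (Equiv.Perm (Fin n))) A := by
  refine GoodOn.mono (Finset.subset_univ A) ?_
  intro f
  have : (Finset.univ.filter (fun σ : Equiv.Perm (Fin n) =>
      ∀ a ∈ (Finset.univ : Finset (Fin n)), σ a = f a)) = {f} := by
    ext σ
    simp [Equiv.ext_iff]
  rw [this]
  simp [Fintype.card_perm]

lemma IsTwiseUniform.goodOn {n t : ℕ} {T : Finset (Equiv.Perm (Fin n))}
    (h : IsTwiseUniform n t T) (htn : t ≤ n) (A : Finset (Fin n)) (hA : A.card ≤ t) :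
    GoodOn T A := by
  obtain ⟨B, hAB, hB⟩ := Finset.exists_superset_card_eq hA (by simpa using htn)
  refine GoodOn.mono hAB ?_
  intro f
  have e := B.equivFinOfCardEq hB
  have := h.2 (fun m => (e.symm m : Fin n)) (fun m => f (e.symm m))
    (Subtype.val_injective.comp e.symm.injective)
    (f.injective.comp (Subtype.val_injective.comp e.symm.injective))
  rw [hB, ← this, mul_assoc, mul_comm (n.descFactorial t), Nat.factorial_mul_descFactorial htn]
  congr 2
  apply Finset.filter_congr
  intro σ _
  constructor
  · intro H m
    exact H _ (e.symm m).2
  · intro H a ha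
    simpa using H (e ⟨a, ha⟩)

lemma exists_perm_extend {n r : ℕ} (i j : Fin r → Fin n) (hi : Function.Injective i)
    (hj : Function.Injective j) : ∃ f : Equiv.Perm (Fin n), ∀ a, f (i a) = j a := by
  classical
  let e : {x // x ∈ Set.range i} ≃ {x // x ∈ Set.range j} :=
    (Equiv.ofInjective i hi).symm.trans (Equiv.ofInjective j hj)
  refine ⟨e.extendSubtype, fun a => ?_⟩
  rw [Equiv.extendSubtype_apply_of_mem e (i a) ⟨a, rfl⟩]
  have : (⟨i a, ⟨a, rfl⟩⟩ : {x // x ∈ Set.range i}) = Equiv.ofInjective i hi a := rfl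
  rw [this]
  simp [e]

lemma count_inj {n r : ℕ} {T : Finset (Equiv.Perm (Fin n))}
    (h : ∀ A : Finset (Fin n), A.card ≤ r → GoodOn T A)
    (i j : Fin r → Fin n) (hi : Function.Injective i) (hj : Function.Injective j) :
    (T.filter (fun σ => ∀ a, σ (i a) = j a)).card * n.factorial
      = T.card * (n - r).factorial := by
  obtain ⟨f, hf⟩ := exists_perm_extend i j hi hj
  have hc : (Finset.univ.image i).card = r := by
    rw [Finset.card_image_of_injective _ hi]; simp
  have := h (Finset.univ.image i) hc.le f
  rw [hc] at this
  rw [← this]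
  simp [hf]

/-- Arbitrary (possibly inconsistent) constraints on few points: `U` behaves like `S_n`. -/
lemma count_gen {n r s m : ℕ} {U : Finset (Equiv.Perm (Fin n))}
    (h : ∀ A : Finset (Fin n), A.card ≤ m → GoodOn U A) (hrs : r + s = m)
    (i j : Fin r → Fin n) (k l : Fin s → Fin n) :
    (U.filter (fun τ => (∀ a, τ (i a) = j a) ∧ ∀ b, τ (k b) = l b)).card * n.factorial
      = U.card * (Finset.univ.filter (fun τ : Equiv.Perm (Fin n) =>
          (∀ a, τ (i a) = j a) ∧ ∀ b, τ (k b) = l b)).card := by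
  by_cases hex : ∃ f : Equiv.Perm (Fin n), (∀ a, f (i a) = j a) ∧ ∀ b, f (k b) = l b
  · obtain ⟨f, hf1, hf2⟩ := hex
    let A := Finset.univ.image i ∪ Finset.univ.image k
    have hA : A.card ≤ m := by
      refine (Finset.card_union_le _ _).trans ?_
      have h1 := Finset.card_image_le (s := Finset.univ) (f := i)
      have h2 := Finset.card_image_le (s := Finset.univ) (f := k)
      simp only [Finset.card_univ, Fintype.card_fin] at h1 h2
      omega
    have hiff : ∀ τ : Equiv.Perm (Fin n), ((∀ a, τ (i a) = j a) ∧ ∀ b, τ (k b) = l b) ↔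
        ∀ a ∈ A, τ a = f a := by
      intro τ
      constructor
      · rintro ⟨h1, h2⟩ a ha
        simp only [A, Finset.mem_union, Finset.mem_image, Finset.mem_univ, true_and] at ha
        rcases ha with ⟨x, rfl⟩ | ⟨x, rfl⟩
        · rw [h1, hf1]
        · rw [h2, hf2]
      · intro H
        exact ⟨fun a => by rw [← hf1, H _ (by simp [A])],
          fun b => by rw [← hf2, H _ (by simp [A])]⟩
    simp only [hiff]
    have h1 := h A hA f
    have h2 := goodOn_univ A f
    rw [Finset.card_univ, Fintype.card_perm, Fintype.card_fin, mul_comm] at h2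
    rw [h1, Nat.eq_of_mul_eq_mul_left (Nat.factorial_pos n) h2]
  · have hno : ∀ V : Finset (Equiv.Perm (Fin n)),
        V.filter (fun τ => (∀ a, τ (i a) = j a) ∧ ∀ b, τ (k b) = l b) = ∅ := by
      intro V
      exact Finset.filter_eq_empty_iff.2 fun τ _ hτ => hex ⟨τ, hτ⟩
    rw [hno, hno]
    simp

lemma card_filter_prod {α β : Type*} (T : Finset α) (U : Finset β) (P : α → β → Prop)
    [∀ a b, Decidable (P a b)] :
    ((T ×ˢ U).filter (fun p => P p.1 p.2)).card = ∑ a ∈ T, (U.filter (P a)).card := by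
  simp only [Finset.card_filter, Finset.sum_product]

/-- If `U` is the whole group. -/
lemma count_full_right {n r s t : ℕ} {T : Finset (Equiv.Perm (Fin n))}
    (h : ∀ A : Finset (Fin n), A.card ≤ t → GoodOn T A) (hrs : r ≤ t ∨ s ≤ t)
    (i j : Fin r → Fin n) (k l : Fin s → Fin n)
    (hi : Function.Injective i) (hj : Function.Injective j)
    (hk : Function.Injective k) (hl : Function.Injective l) :
    (∑ σ ∈ T, (Finset.univ.filter (fun τ : Equiv.Perm (Fin n) =>
          (∀ a, τ (σ (i a)) = j a) ∧ ∀ b, τ (k b) = l b)).card) * n.factorial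
      = T.card * (n - r).factorial * (n - s).factorial := by
  have full : ∀ (m : ℕ) (x y : Fin m → Fin n), Function.Injective x → Function.Injective y →
      (Finset.univ.filter (fun τ : Equiv.Perm (Fin n) => ∀ b, τ (x b) = y b)).card
        = (n - m).factorial := by
    intro m x y hx hy
    have := count_inj (T := Finset.univ) (fun A _ => goodOn_univ A) x y hx hy
    rw [Finset.card_univ, Fintype.card_perm, Fintype.card_fin, mul_comm] at this
    exact Nat.eq_of_mul_eq_mul_left (Nat.factorial_pos n) this
  rcases hrs with hr | hs
  · have e : ∑ σ ∈ T, (Finset.univ.filter (fun τ : Equiv.Perm (Fin n) =>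
          (∀ a, τ (σ (i a)) = j a) ∧ ∀ b, τ (k b) = l b)).card
        = ∑ τ ∈ Finset.univ.filter (fun τ : Equiv.Perm (Fin n) => ∀ b, τ (k b) = l b),
          (T.filter (fun σ => ∀ a, σ (i a) = τ.symm (j a))).card := by
      simp only [Finset.card_filter, Finset.sum_filter]
      rw [Finset.sum_comm]
      refine Finset.sum_congr rfl fun τ _ => ?_
      split_ifs with hτ
      · refine Finset.sum_congr rfl fun σ _ => ?_
        simp [hτ, Equiv.eq_symm_apply]
      · simp [hτ]
    rw [e, Finset.sum_mul, Finset.sum_congr rfl fun τ _ =>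
      count_inj (fun A hA => h A (hA.trans hr)) i (fun a => τ.symm (j a)) hi
        (τ.symm.injective.comp hj), Finset.sum_const, full s k l hk hl, smul_eq_mul]
    ring
  · have e : ∑ σ ∈ T, (Finset.univ.filter (fun τ : Equiv.Perm (Fin n) =>
          (∀ a, τ (σ (i a)) = j a) ∧ ∀ b, τ (k b) = l b)).card
        = ∑ ρ ∈ Finset.univ.filter (fun ρ : Equiv.Perm (Fin n) => ∀ a, ρ (i a) = j a),
          (T.filter (fun σ => ∀ b, σ (ρ.symm (l b)) = k b)).card := by
      simp only [Finset.card_filter, Finset.sum_filter]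
      have : ∀ σ ∈ T, (∑ τ : Equiv.Perm (Fin n),
          if (∀ a, τ (σ (i a)) = j a) ∧ ∀ b, τ (k b) = l b then 1 else 0)
          = ∑ ρ : Equiv.Perm (Fin n),
            if (∀ a, ρ (i a) = j a) ∧ ∀ b, σ (ρ.symm (l b)) = k b then 1 else 0 := by
        intro σ _
        refine Fintype.sum_equiv (Equiv.mulRight σ) _ _ fun τ => ?_
        refine if_congr ?_ rfl rfl
        refine and_congr (by simp) (forall_congr' fun b => ?_)
        have hsymm : σ (((Equiv.mulRight σ) τ).symm (l b)) = τ.symm (l b) := by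
          rw [Equiv.eq_symm_apply, ← Equiv.Perm.mul_apply]
          exact Equiv.apply_symm_apply (τ * σ) (l b)
        rw [hsymm, Equiv.symm_apply_eq]
        exact eq_comm
      rw [Finset.sum_congr rfl this, Finset.sum_comm]
      refine Finset.sum_congr rfl fun ρ _ => ?_
      split_ifs with hρ
      · simp [hρ]
      · simp [hρ]
    rw [e, Finset.sum_mul, Finset.sum_congr rfl fun ρ _ =>
      count_inj (fun A hA => h A (hA.trans hs)) (fun b => ρ.symm (l b)) k
        (ρ.symm.injective.comp hl) hk, Finset.sum_const, full r i j hi hj, smul_eq_mul]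
    ring

/-- If `σ` is drawn from a `t`-wise uniform set `T` and `τ` independently from a `(2t+1)`-wise
uniform set `U`, then for `r + s = 2t+1` and distinct indices as below,
`|{(σ,τ) : τ∘σ(i_a)=j_a ∀a, τ(k_b)=ℓ_b ∀b}| · (n!)² = |T|·|U|·(n−r)!·(n−s)!`. -/
theorem pair_behaves_uniform (n t : ℕ) (hn : 1 ≤ n) (ht : 2 * t + 1 ≤ n)
    (T U : Finset (Equiv.Perm (Fin n)))
    (hT : IsTwiseUniform n t T) (hU : IsTwiseUniform n (2 * t + 1) U)
    (r s : ℕ) (hrs : r + s = 2 * t + 1)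
    (i j : Fin r → Fin n) (k l : Fin s → Fin n)
    (hi : Function.Injective i) (hj : Function.Injective j)
    (hk : Function.Injective k) (hl : Function.Injective l) :
    ((T ×ˢ U).filter
        (fun p => (∀ a, p.2 (p.1 (i a)) = j a) ∧ ∀ b, p.2 (k b) = l b)).card
        * n.factorial ^ 2
      = T.card * U.card * (n - r).factorial * (n - s).factorial := by
  rw [card_filter_prod T U (fun σ τ => (∀ a, τ (σ (i a)) = j a) ∧ ∀ b, τ (k b) = l b),
    pow_two, ← mul_assoc, Finset.sum_mul,
    Finset.sum_congr rfl fun σ _ =>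
      count_gen (hU.goodOn ht) hrs (fun a => σ (i a)) j k l,
    ← Finset.mul_sum, mul_assoc,
    count_full_right (hT.goodOn (by omega)) (by omega) i j k l hi hj hk hl]
  ring
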